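/- arXiv:2007.12893 — 2 statements merged into one kernel-verified Lean document; each statement's English description precedes it below -/
import Mathlib

section
/- Let P = conv{x_1,…,x_m} ⊂ ℝ^d be a full-dimensional compact convex polytope and let Σ be a triangulation of P using only the vertices x_1,…,x_m. Then there is a neighborhood U of 0 in ℝ^d such that for all t = (t_1,…,t_d) ∈ U the moment power series converges absolutely and ∑_{i_1,…,i_d ≥ 0} ((i_1+⋯+i_d+d)!/(i_1!⋯i_d!·d!)) · m_{i_1…i_d} · t_1^{i_1}⋯t_d^{i_d} = (1/V_d(P)) ∑_{σ∈Σ} V_d(σ) / ∏_{k∈σ} (1 − x_{k,1}t_1 − ⋯ − x_{k,d}t_d), where the product is over the indices k of the vertices of σ. Moreover the right-hand side is independent of the choice of triangulation Σ. -/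
open MeasureTheory Finset

/-- A triangulation of the polytope `P = conv{x_1,…,x_m} ⊆ ℝ^d` using only the vertices
`x_1,…,x_m`: a finite collection of `d`-simplices (given by their vertex index sets),
whose union is `P` and whose interiors are pairwise disjoint. -/
structure Triangulation (d m : ℕ) (x : Fin m → (Fin d → ℝ)) where
  simplices : Finset (Finset (Fin m))
  card_eq : ∀ σ ∈ simplices, σ.card = d + 1
  indep : ∀ σ ∈ simplices, AffineIndependent ℝ (fun k : {k // k ∈ σ} => x k.1)
  covers : (⋃ σ ∈ simplices, convexHull ℝ (x '' ↑σ)) = convexHull ℝ (Set.range x)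
  disj : ∀ σ ∈ simplices, ∀ τ ∈ simplices, σ ≠ τ →
    interior (convexHull ℝ (x '' ↑σ)) ∩ interior (convexHull ℝ (x '' ↑τ)) = ∅

/-- The moments of the uniform distribution on `P = conv{x_1,…,x_m}`:
`m_{i_1…i_d} = (1/V_d(P)) ∫_P x_1^{i_1}⋯x_d^{i_d} dλ(x)`. -/
noncomputable def moment (d m : ℕ) (x : Fin m → (Fin d → ℝ)) (i : Fin d → ℕ) : ℝ :=
  ((volume (convexHull ℝ (Set.range x))).toReal)⁻¹ *
    ∫ y in convexHull ℝ (Set.range x), ∏ l, y l ^ i l ∂volume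

/-- The rational function `∑_{σ∈Σ} V_d(σ) / ∏_{k∈σ} (1 − ⟨x_k, t⟩)` attached to a
triangulation `Σ` of `P`. -/
noncomputable def ratGF (d m : ℕ) (x : Fin m → (Fin d → ℝ)) (T : Triangulation d m x)
    (t : Fin d → ℝ) : ℝ :=
  ∑ σ ∈ T.simplices,
    (volume (convexHull ℝ (x '' ↑σ))).toReal / ∏ k ∈ σ, (1 - ∑ j, x k j * t j)

section Projective

variable {E : Type*} [NormedAddCommGroup E] [NormedSpace ℝ E]

/-- The projective transformation `y ↦ y / (1 - φ y)`. -/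
noncomputable def projMap (φ : E →L[ℝ] ℝ) (y : E) : E := (1 - φ y)⁻¹ • y

lemma one_sub_neg_apply_projMap {φ : E →L[ℝ] ℝ} {y : E} (hy : φ y < 1) :
    1 - (-φ) (projMap φ y) = (1 - φ y)⁻¹ := by
  have h : 1 - φ y ≠ 0 := by linarith
  simp only [projMap, neg_apply, map_smul, smul_eq_mul]
  field_simp
  ring

lemma projMap_neg_projMap {φ : E →L[ℝ] ℝ} {y : E} (hy : φ y < 1) :
    projMap (-φ) (projMap φ y) = y := by
  have h : 1 - φ y ≠ 0 := by linarith
  rw [projMap, one_sub_neg_apply_projMap hy, inv_inv, projMap, smul_inv_smul₀ h]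

lemma neg_apply_projMap_lt_one {φ : E →L[ℝ] ℝ} {y : E} (hy : φ y < 1) :
    (-φ) (projMap φ y) < 1 := by
  have h := one_sub_neg_apply_projMap hy
  have : 0 < (1 - φ y)⁻¹ := inv_pos.2 (by linarith)
  linarith

lemma convex_preimage_projMap (φ : E →L[ℝ] ℝ) {C : Set E} (hC : Convex ℝ C) :
    Convex ℝ {y | φ y < 1 ∧ projMap φ y ∈ C} := by
  rintro y ⟨hy, hyC⟩ z ⟨hz, hzC⟩ α β hα hβ hαβ
  have hlt : φ (α • y + β • z) < 1 := (convex_halfSpace_lt φ.isLinear 1) hy hz hα hβ hαβ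
  refine ⟨hlt, ?_⟩
  have hy' : 0 < 1 - φ y := by linarith
  have hz' : 0 < 1 - φ z := by linarith
  have hs : 0 < 1 - φ (α • y + β • z) := by linarith
  have hsum : 1 - φ (α • y + β • z) = α * (1 - φ y) + β * (1 - φ z) := by
    simp only [map_add, map_smul, smul_eq_mul]
    linear_combination -hαβ
  have key := hC hyC hzC
    (a := α * (1 - φ y) / (1 - φ (α • y + β • z)))
    (b := β * (1 - φ z) / (1 - φ (α • y + β • z)))
    (by positivity) (by positivity) (by rw [← add_div, ← hsum, div_self hs.ne'])
  convert key using 1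
  simp only [projMap, smul_smul, smul_add]
  congr 2 <;> field_simp

lemma projMap_image_convexHull_subset {φ : E →L[ℝ] ℝ} {S : Set E} (hS : ∀ y ∈ S, φ y < 1) :
    projMap φ '' convexHull ℝ S ⊆ convexHull ℝ (projMap φ '' S) := by
  rintro _ ⟨y, hy, rfl⟩
  have hsub : S ⊆ {y | φ y < 1 ∧ projMap φ y ∈ convexHull ℝ (projMap φ '' S)} := fun y hy =>
    ⟨hS y hy, subset_convexHull ℝ _ (Set.mem_image_of_mem _ hy)⟩
  exact (convexHull_min hsub (convex_preimage_projMap φ (convex_convexHull ℝ _)) hy).2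

lemma apply_lt_one_of_mem_convexHull {φ : E →L[ℝ] ℝ} {S : Set E} (hS : ∀ y ∈ S, φ y < 1)
    {y : E} (hy : y ∈ convexHull ℝ S) : φ y < 1 :=
  convexHull_min hS (convex_halfSpace_lt φ.isLinear 1) hy

lemma projMap_image_convexHull {φ : E →L[ℝ] ℝ} {S : Set E} (hS : ∀ y ∈ S, φ y < 1) :
    projMap φ '' convexHull ℝ S = convexHull ℝ (projMap φ '' S) := by
  refine (projMap_image_convexHull_subset hS).antisymm fun z hz => ?_
  have hS' : ∀ y ∈ projMap φ '' S, (-φ) y < 1 := by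
    rintro _ ⟨y, hy, rfl⟩
    exact neg_apply_projMap_lt_one (hS y hy)
  have hz1 := apply_lt_one_of_mem_convexHull hS' hz
  have hmem := projMap_image_convexHull_subset hS' (Set.mem_image_of_mem (projMap (-φ)) hz)
  have himg : projMap (-φ) '' (projMap φ '' S) = S := by
    rw [Set.image_image, Set.image_congr fun y hy => projMap_neg_projMap (hS y hy), Set.image_id']
  rw [himg] at hmem
  refine ⟨_, hmem, ?_⟩
  simpa using projMap_neg_projMap hz1

lemma injOn_projMap {φ : E →L[ℝ] ℝ} {S : Set E} (hS : ∀ y ∈ S, φ y < 1) :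
    Set.InjOn (projMap φ) S := fun y hy z hz h => by
  rw [← projMap_neg_projMap (hS y hy), h, projMap_neg_projMap (hS z hz)]

/-- The derivative of `projMap φ` at `y`. -/
noncomputable def projMapDeriv (φ : E →L[ℝ] ℝ) (y : E) : E →L[ℝ] E :=
  (1 - φ y)⁻¹ • (ContinuousLinearMap.id ℝ E + ((1 - φ y)⁻¹ • φ).smulRight y)

lemma hasFDerivAt_projMap {φ : E →L[ℝ] ℝ} {y : E} (hy : φ y < 1) :
    HasFDerivAt (projMap φ) (projMapDeriv φ y) y := by
  have h : 1 - φ y ≠ 0 := by linarith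
  have h1 : HasFDerivAt (fun y => 1 - φ y) (-φ) y := φ.hasFDerivAt.const_sub 1
  have h2 := ((hasDerivAt_inv h).comp_hasFDerivAt y h1).smul (hasFDerivAt_id y)
  refine h2.congr_fderiv ?_
  ext v
  simp [projMapDeriv, smul_smul]
  field_simp

lemma det_id_add_smulRight [FiniteDimensional ℝ E] (φ : E →L[ℝ] ℝ) (y : E) :
    (ContinuousLinearMap.id ℝ E + φ.smulRight y).det = 1 + φ y := by
  exact LinearMap.transvection.det (φ : E →ₗ[ℝ] ℝ) y

lemma det_projMapDeriv [FiniteDimensional ℝ E] {φ : E →L[ℝ] ℝ} {y : E} (hy : φ y < 1) :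
    (projMapDeriv φ y).det = ((1 - φ y) ^ (Module.finrank ℝ E + 1))⁻¹ := by
  have h : 1 - φ y ≠ 0 := by linarith
  have h1 := det_id_add_smulRight ((1 - φ y)⁻¹ • φ) y
  rw [ContinuousLinearMap.det] at h1
  rw [projMapDeriv, ContinuousLinearMap.det, ContinuousLinearMap.toLinearMap_smul,
    LinearMap.det_smul, h1, pow_succ, mul_inv, inv_pow]
  simp
  field_simp
  ring_nf
  simp

lemma setIntegral_inv_pow_eq_measure_image_projMap [FiniteDimensional ℝ E] [MeasurableSpace E]
    [BorelSpace E] (μ : Measure E) [μ.IsAddHaarMeasure] {φ : E →L[ℝ] ℝ} {S : Set E}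
    (hm : MeasurableSet S) (hS : ∀ y ∈ S, φ y < 1) :
    ∫ y in S, ((1 - φ y) ^ (Module.finrank ℝ E + 1))⁻¹ ∂μ = (μ (projMap φ '' S)).toReal := by
  have h := integral_image_eq_integral_abs_det_fderiv_smul μ hm
    (fun y hy => (hasFDerivAt_projMap (hS y hy)).hasFDerivWithinAt) (injOn_projMap hS)
    (fun _ => (1 : ℝ))
  rw [setIntegral_const] at h
  simp only [smul_eq_mul, mul_one] at h
  rw [← Measure.real, h]
  refine setIntegral_congr_fun hm fun y hy => ?_
  have : 0 < 1 - φ y := by linarith [hS y hy]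
  simp only [det_projMapDeriv (hS y hy)]
  rw [abs_of_pos (by positivity)]

end Projective

section Simplex

variable {d : ℕ}

/-- The linear map sending the `i`-th standard basis vector to `v (i + 1) - v 0`. -/
noncomputable def edgeMap (v : Fin (d + 1) → Fin d → ℝ) : (Fin d → ℝ) →ₗ[ℝ] (Fin d → ℝ) :=
  (Pi.basisFun ℝ (Fin d)).constr ℝ fun i => v i.succ - v 0

open Pointwise in
lemma volume_convexHull_range (v : Fin (d + 1) → Fin d → ℝ) :
    volume (convexHull ℝ (Set.range v)) = ENNReal.ofReal |LinearMap.det (edgeMap v)| *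
      volume (convexHull ℝ (Set.range
        (Fin.cons 0 (Pi.basisFun ℝ (Fin d)) : Fin (d + 1) → Fin d → ℝ))) := by
  have hv : Set.range v = v 0 +ᵥ edgeMap v '' Set.range
      (Fin.cons 0 (Pi.basisFun ℝ (Fin d)) : Fin (d + 1) → Fin d → ℝ) := by
    rw [← Set.range_comp, ← Set.image_vadd, ← Set.range_comp]
    congr 1
    funext k
    refine Fin.cases ?_ (fun i => ?_) k
    · simp
    · rw [Function.comp_apply, Function.comp_apply, Fin.cons_succ, edgeMap,
        Module.Basis.constr_basis, vadd_eq_add, add_sub_cancel]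
  rw [← Measure.addHaar_image_linearMap, LinearMap.image_convexHull, hv, convexHull_vadd,
    measure_vadd]

lemma edgeMap_projMap {φ : (Fin d → ℝ) →L[ℝ] ℝ} {v : Fin (d + 1) → Fin d → ℝ}
    (hv : ∀ k, φ (v k) < 1) :
    edgeMap (fun k => projMap φ (v k)) =
      (ContinuousLinearMap.id ℝ (Fin d → ℝ) + ((1 - φ (v 0))⁻¹ • φ).smulRight (v 0) :
        (Fin d → ℝ) →L[ℝ] (Fin d → ℝ)).toLinearMap ∘ₗ edgeMap v ∘ₗ
      Matrix.toLin' (Matrix.diagonal fun i : Fin d => (1 - φ (v i.succ))⁻¹) := by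
  refine (Pi.basisFun ℝ (Fin d)).ext fun i => ?_
  have h0 : 1 - φ (v 0) ≠ 0 := by linarith [hv 0]
  have hi : 1 - φ (v i.succ) ≠ 0 := by linarith [hv i.succ]
  have h : Matrix.toLin' (Matrix.diagonal fun i : Fin d => (1 - φ (v i.succ))⁻¹)
      (Pi.basisFun ℝ (Fin d) i) = (1 - φ (v i.succ))⁻¹ • Pi.basisFun ℝ (Fin d) i := by
    simp [← Pi.single_smul]
  rw [LinearMap.comp_apply, LinearMap.comp_apply, h, map_smul, edgeMap, edgeMap,
    Module.Basis.constr_basis, Module.Basis.constr_basis]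
  ext j
  simp [projMap]
  field_simp
  ring

lemma setIntegral_simplex {φ : (Fin d → ℝ) →L[ℝ] ℝ} {v : Fin (d + 1) → Fin d → ℝ}
    (hv : ∀ k, φ (v k) < 1) :
    ∫ y in convexHull ℝ (Set.range v), ((1 - φ y) ^ (d + 1))⁻¹ =
      (volume (convexHull ℝ (Set.range v))).toReal / ∏ k, (1 - φ (v k)) := by
  have hS : ∀ y ∈ Set.range v, φ y < 1 := by
    rintro _ ⟨k, rfl⟩
    exact hv k
  have h := setIntegral_inv_pow_eq_measure_image_projMap volume
    ((Set.finite_range v).isCompact_convexHull (𝕜 := ℝ)).measurableSet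
    (fun y hy => apply_lt_one_of_mem_convexHull hS hy)
  rw [Module.finrank_fin_fun] at h
  have h0 : 0 < 1 - φ (v 0) := by linarith [hv 0]
  have hpos : 0 < ∏ i : Fin d, (1 - φ (v i.succ)) :=
    Finset.prod_pos fun i _ => by linarith [hv i.succ]
  have hdet := det_id_add_smulRight ((1 - φ (v 0))⁻¹ • φ) (v 0)
  rw [ContinuousLinearMap.det] at hdet
  rw [h, projMap_image_convexHull hS, ← Set.range_comp, volume_convexHull_range,
    volume_convexHull_range v, Function.comp_def, edgeMap_projMap hv, LinearMap.det_comp,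
    LinearMap.det_comp, hdet, LinearMap.det_toLin', Matrix.det_diagonal, Finset.prod_inv_distrib,
    Fin.prod_univ_succ]
  have h1 : 1 + ((1 - φ (v 0))⁻¹ • φ) (v 0) = (1 - φ (v 0))⁻¹ := by
    simp
    field_simp
    ring
  rw [h1, abs_mul, abs_mul, abs_of_pos (inv_pos.2 h0), abs_of_pos (inv_pos.2 hpos)]
  simp only [ENNReal.toReal_mul]
  rw [ENNReal.toReal_ofReal (by positivity), ENNReal.toReal_ofReal (by positivity)]
  field_simp

end Simplex
section Series

variable {d : ℕ}

lemma coeff_eq_choose_mul_multinomial (i : Fin d → ℕ) :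
    (Nat.factorial (∑ j, i j + d) : ℝ) / ((∏ j, (Nat.factorial (i j) : ℝ)) * Nat.factorial d) =
      ((∑ j, i j + d).choose d : ℝ) * (Nat.multinomial univ i : ℝ) := by
  have h1 : (∏ j, (Nat.factorial (i j) : ℝ)) * Nat.multinomial univ i =
      Nat.factorial (∑ j, i j) := by
    exact_mod_cast Nat.multinomial_spec univ i
  have h2 : ((∑ j, i j + d).choose d : ℝ) * Nat.factorial (∑ j, i j) * Nat.factorial d =
      Nat.factorial (∑ j, i j + d) := by
    have := Nat.add_choose_mul_factorial_mul_factorial (∑ j, i j) d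
    exact_mod_cast this
  have h3 : (∏ j, (Nat.factorial (i j) : ℝ)) ≠ 0 :=
    Finset.prod_ne_zero_iff.2 fun j _ => by positivity
  rw [← h2, ← h1]
  field_simp

lemma existsUnique_mem_piAntidiag (i : Fin d → ℕ) :
    ∃! n, i ∈ ((piAntidiag univ n : Finset (Fin d → ℕ)) : Set (Fin d → ℕ)) :=
  ⟨∑ j, i j, by simp, fun n hn => by simpa [eq_comm] using hn⟩

lemma sum_piAntidiag_coeff (u : Fin d → ℝ) (n : ℕ) :
    ∑ i ∈ piAntidiag univ n,
      (Nat.factorial (∑ j, i j + d) : ℝ) / ((∏ j, (Nat.factorial (i j) : ℝ)) * Nat.factorial d) *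
        ∏ j, u j ^ i j = ((n + d).choose d : ℝ) * (∑ j, u j) ^ n := by
  rw [Finset.sum_pow_eq_sum_piAntidiag, Finset.mul_sum]
  refine Finset.sum_congr rfl fun i hi => ?_
  have : ∑ j, i j = n := by simpa using hi
  rw [coeff_eq_choose_mul_multinomial, this, mul_assoc]

lemma summable_coeff_mul_prod_pow_of_nonneg {u : Fin d → ℝ} (hu : ∀ j, 0 ≤ u j)
    (hsum : ∑ j, u j < 1) :
    Summable fun i : Fin d → ℕ =>
      (Nat.factorial (∑ j, i j + d) : ℝ) / ((∏ j, (Nat.factorial (i j) : ℝ)) * Nat.factorial d) *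
        ∏ j, u j ^ i j := by
  rw [summable_partition (fun i => ?_) existsUnique_mem_piAntidiag]
  · refine ⟨fun n => Summable.of_finite, ?_⟩
    have h : ‖∑ j, u j‖ < 1 := by
      rwa [Real.norm_of_nonneg (Finset.sum_nonneg fun j _ => hu j)]
    refine (summable_choose_mul_geometric_of_norm_lt_one d h).congr fun n => ?_
    rw [← sum_piAntidiag_coeff, eq_comm]
    exact Finset.tsum_subtype' (piAntidiag univ n) fun i : Fin d → ℕ =>
      (Nat.factorial (∑ j, i j + d) : ℝ) / ((∏ j, (Nat.factorial (i j) : ℝ)) * Nat.factorial d) *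
        ∏ j, u j ^ i j
  · have := Finset.prod_nonneg fun j (_ : j ∈ univ) => pow_nonneg (hu j) (i j)
    dsimp only [Pi.zero_apply]
    positivity

lemma hasSum_coeff_mul_prod_pow {u : Fin d → ℝ} (hsum : ∑ j, |u j| < 1) :
    HasSum (fun i : Fin d → ℕ =>
      (Nat.factorial (∑ j, i j + d) : ℝ) / ((∏ j, (Nat.factorial (i j) : ℝ)) * Nat.factorial d) *
        ∏ j, u j ^ i j) ((1 - ∑ j, u j) ^ (d + 1))⁻¹ := by
  have hs := Summable.of_norm_bounded
    (summable_coeff_mul_prod_pow_of_nonneg (fun j => abs_nonneg (u j)) hsum)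
    (f := fun i : Fin d → ℕ =>
      (Nat.factorial (∑ j, i j + d) : ℝ) / ((∏ j, (Nat.factorial (i j) : ℝ)) * Nat.factorial d) *
        ∏ j, u j ^ i j) fun i => by
      rw [norm_mul, Real.norm_of_nonneg (by positivity), norm_prod]
      simp only [norm_pow, Real.norm_eq_abs, le_refl]
  have h : ‖∑ j, u j‖ < 1 := (Finset.abs_sum_le_sum_abs _ _).trans_lt hsum
  have h1 := (Set.sigmaEquiv _ existsUnique_mem_piAntidiag).hasSum_iff.2 hs.hasSum
  have h2 := h1.sigma (g := fun n => ((n + d).choose d : ℝ) * (∑ j, u j) ^ n) fun n => by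
    rw [← sum_piAntidiag_coeff]
    exact Finset.hasSum (piAntidiag univ n) _
  have h3 := h2.unique (hasSum_choose_mul_geometric_of_norm_lt_one d h)
  rw [one_div] at h3
  rw [← h3]
  exact hs.hasSum

end Series

section Triangulation

variable {d m : ℕ} {x : Fin m → Fin d → ℝ}

lemma isCompact_convexHull_image (x : Fin m → Fin d → ℝ) (σ : Finset (Fin m)) :
    IsCompact (convexHull ℝ (x '' ↑σ)) :=
  (σ.finite_toSet.image x).isCompact_convexHull (𝕜 := ℝ)

lemma Triangulation.aedisjoint (T : Triangulation d m x) :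
    Pairwise (Function.onFun (AEDisjoint volume)
      fun σ : T.simplices => convexHull ℝ (x '' (σ : Finset (Fin m)))) := by
  intro σ τ hne
  have hd := T.disj σ σ.2 τ τ.2 (fun h => hne (Subtype.ext h))
  refine measure_mono_null (t := frontier (convexHull ℝ (x '' (σ : Finset (Fin m)))) ∪
    frontier (convexHull ℝ (x '' (τ : Finset (Fin m))))) ?_ ?_
  · rintro y ⟨hy1, hy2⟩
    by_contra hy
    rw [Set.mem_union, not_or] at hy
    have hy' : y ∈ interior (convexHull ℝ (x '' (σ : Finset (Fin m)))) ∩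
        interior (convexHull ℝ (x '' (τ : Finset (Fin m)))) := by
      refine ⟨?_, ?_⟩
      · by_contra h
        exact hy.1 ⟨subset_closure hy1, h⟩
      · by_contra h
        exact hy.2 ⟨subset_closure hy2, h⟩
    rw [hd] at hy'
    exact hy'
  · exact measure_union_null ((convex_convexHull ℝ _).addHaar_frontier _)
      ((convex_convexHull ℝ _).addHaar_frontier _)

lemma Triangulation.setIntegral_eq_sum (T : Triangulation d m x) {f : (Fin d → ℝ) → ℝ}
    (hf : IntegrableOn f (convexHull ℝ (Set.range x))) :
    ∫ y in convexHull ℝ (Set.range x), f y =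
      ∑ σ ∈ T.simplices, ∫ y in convexHull ℝ (x '' ↑σ), f y := by
  have hU : ⋃ σ : T.simplices, convexHull ℝ (x '' (σ : Finset (Fin m))) =
      convexHull ℝ (Set.range x) := by
    rw [← T.covers, Set.iUnion_subtype]
  rw [← hU] at hf ⊢
  rw [integral_iUnion_ae (s := fun σ : T.simplices => convexHull ℝ (x '' (σ : Finset (Fin m))))
    (fun σ =>
    (isCompact_convexHull_image x σ).measurableSet.nullMeasurableSet) T.aedisjoint hf,
    tsum_fintype, Finset.sum_coe_sort T.simplices
      (fun σ => ∫ y in convexHull ℝ (x '' (σ : Set (Fin m))), f y)]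

/-- The linear functional `y ↦ ∑ j, y j * t j`. -/
noncomputable def pairing (t : Fin d → ℝ) : (Fin d → ℝ) →L[ℝ] ℝ :=
  ∑ j, t j • ContinuousLinearMap.proj (R := ℝ) (φ := fun _ : Fin d => ℝ) j

lemma pairing_apply (t y : Fin d → ℝ) : pairing t y = ∑ j, y j * t j := by
  simp [pairing, mul_comm]

lemma Triangulation.setIntegral_eq_ratGF (T : Triangulation d m x) {t : Fin d → ℝ}
    (ht : ∀ k, pairing t (x k) < 1) :
    ∫ y in convexHull ℝ (Set.range x), ((1 - pairing t y) ^ (d + 1))⁻¹ = ratGF d m x T t := by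
  have hint : IntegrableOn (fun y => ((1 - pairing t y) ^ (d + 1))⁻¹)
      (convexHull ℝ (Set.range x)) := by
    refine ContinuousOn.integrableOn_compact ((Set.finite_range x).isCompact_convexHull (𝕜 := ℝ)) ?_
    refine ContinuousOn.inv₀ (by fun_prop) fun y hy => pow_ne_zero _ ?_
    have := apply_lt_one_of_mem_convexHull (by rintro _ ⟨k, rfl⟩; exact ht k) hy
    linarith
  rw [T.setIntegral_eq_sum hint, ratGF]
  refine Finset.sum_congr rfl fun σ hσ => ?_
  have hr : x '' ↑σ = Set.range (x ∘ σ.orderEmbOfFin (T.card_eq σ hσ)) := by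
    rw [Set.range_comp, Finset.range_orderEmbOfFin]
  rw [hr, setIntegral_simplex (v := x ∘ σ.orderEmbOfFin (T.card_eq σ hσ)) fun k => ht _]
  congr 1
  simp only [← pairing_apply]
  conv_rhs => rw [← Finset.map_orderEmbOfFin_univ σ (T.card_eq σ hσ), Finset.prod_map]
  rfl

lemma moment_series_of_bound {R : ℝ} (hR : ∀ y ∈ convexHull ℝ (Set.range x), ∀ j, |y j| ≤ R)
    (hR0 : 0 ≤ R) {t : Fin d → ℝ} (ht : ∑ j, R * |t j| < 1) :
    (Summable fun i : Fin d → ℕ =>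
        |(Nat.factorial (∑ j, i j + d) : ℝ) /
            ((∏ j, (Nat.factorial (i j) : ℝ)) * Nat.factorial d) *
          moment d m x i * ∏ j, t j ^ i j|) ∧
      (∑' i : Fin d → ℕ,
          (Nat.factorial (∑ j, i j + d) : ℝ) /
              ((∏ j, (Nat.factorial (i j) : ℝ)) * Nat.factorial d) *
            moment d m x i * ∏ j, t j ^ i j)
        = ((volume (convexHull ℝ (Set.range x))).toReal)⁻¹ *
          ∫ y in convexHull ℝ (Set.range x), ((1 - pairing t y) ^ (d + 1))⁻¹ := by
  have hK : IsCompact (convexHull ℝ (Set.range x)) :=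
    (Set.finite_range x).isCompact_convexHull (𝕜 := ℝ)
  have : IsFiniteMeasure (volume.restrict (convexHull ℝ (Set.range x))) :=
    ⟨by simpa using hK.measure_lt_top⟩
  have hb := summable_coeff_mul_prod_pow_of_nonneg (u := fun j => R * |t j|)
    (fun j => by positivity) ht
  have key := hasSum_integral_of_dominated_convergence
    (μ := volume.restrict (convexHull ℝ (Set.range x)))
    (F := fun (i : Fin d → ℕ) y => (Nat.factorial (∑ j, i j + d) : ℝ) /
      ((∏ j, (Nat.factorial (i j) : ℝ)) * Nat.factorial d) * ∏ j, (y j * t j) ^ i j)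
    (f := fun y => ((1 - pairing t y) ^ (d + 1))⁻¹)
    (fun i _ => (Nat.factorial (∑ j, i j + d) : ℝ) /
      ((∏ j, (Nat.factorial (i j) : ℝ)) * Nat.factorial d) * ∏ j, (R * |t j|) ^ i j)
    (fun i => Continuous.aestronglyMeasurable (by fun_prop))
    (fun i => (ae_restrict_iff' hK.measurableSet).2 <| .of_forall fun y hy => by
      rw [norm_mul, Real.norm_of_nonneg (by positivity), norm_prod]
      gcongr with j
      rw [norm_pow, norm_mul]
      gcongr
      · exact hR y hy j
      · rfl)
    (.of_forall fun _ => hb) (integrable_const _)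
    ((ae_restrict_iff' hK.measurableSet).2 <| .of_forall fun y hy => by
      rw [pairing_apply]
      refine hasSum_coeff_mul_prod_pow (u := fun j => y j * t j) (lt_of_le_of_lt ?_ ht)
      gcongr with j
      rw [abs_mul]
      gcongr
      exact hR y hy j)
  have key' := key.mul_left ((volume (convexHull ℝ (Set.range x))).toReal)⁻¹
  have heq : ∀ i : Fin d → ℕ, ((volume (convexHull ℝ (Set.range x))).toReal)⁻¹ *
      ∫ y in convexHull ℝ (Set.range x), (Nat.factorial (∑ j, i j + d) : ℝ) /
        ((∏ j, (Nat.factorial (i j) : ℝ)) * Nat.factorial d) * ∏ j, (y j * t j) ^ i j =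
      (Nat.factorial (∑ j, i j + d) : ℝ) /
        ((∏ j, (Nat.factorial (i j) : ℝ)) * Nat.factorial d) *
          moment d m x i * ∏ j, t j ^ i j := fun i => by
    simp only [mul_pow, Finset.prod_mul_distrib]
    rw [integral_const_mul, integral_mul_const, moment]
    ring
  simp only [heq] at key'
  exact ⟨key'.summable.abs, key'.tsum_eq⟩

end Triangulation

/-- For a full-dimensional compact convex polytope
`P = conv{x_1,…,x_m} ⊆ ℝ^d` with a triangulation `Σ` using only the vertices of `P`,
there is a neighborhood `U` of `0` such that for all `t ∈ U` the moment power series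
converges absolutely and
`∑_{i_1,…,i_d ≥ 0} ((i_1+⋯+i_d+d)!/(i_1!⋯i_d!·d!)) m_{i_1…i_d} t_1^{i_1}⋯t_d^{i_d}
  = (1/V_d(P)) ∑_{σ∈Σ} V_d(σ)/∏_{k∈σ}(1 − ⟨x_k,t⟩)`;
moreover the right-hand side is independent of the triangulation. -/
theorem stmt_1 (d m : ℕ) (x : Fin m → (Fin d → ℝ))
    (hfull : (interior (convexHull ℝ (Set.range x))).Nonempty)
    (T T' : Triangulation d m x) :
    ∃ U ∈ nhds (0 : Fin d → ℝ), ∀ t ∈ U,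
      (Summable fun i : Fin d → ℕ =>
        |(Nat.factorial (∑ j, i j + d) : ℝ) /
            ((∏ j, (Nat.factorial (i j) : ℝ)) * Nat.factorial d) *
          moment d m x i * ∏ j, t j ^ i j|) ∧
      (∑' i : Fin d → ℕ,
          (Nat.factorial (∑ j, i j + d) : ℝ) /
              ((∏ j, (Nat.factorial (i j) : ℝ)) * Nat.factorial d) *
            moment d m x i * ∏ j, t j ^ i j)
        = ((volume (convexHull ℝ (Set.range x))).toReal)⁻¹ * ratGF d m x T t ∧
      ratGF d m x T t = ratGF d m x T' t := by
  obtain ⟨R, hR⟩ :=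
    ((Set.finite_range x).isCompact_convexHull (𝕜 := ℝ)).isBounded.exists_norm_le
  have hR' : ∀ y ∈ convexHull ℝ (Set.range x), ∀ j, |y j| ≤ max R 0 := fun y hy j =>
    (norm_le_pi_norm y j).trans ((hR y hy).trans (le_max_left _ _))
  refine ⟨{t | ∑ j, max R 0 * |t j| < 1},
    (isOpen_lt (by fun_prop) continuous_const).mem_nhds (by simp), fun t ht => ?_⟩
  have hx : ∀ k, pairing t (x k) < 1 := fun k => by
    rw [pairing_apply]
    refine lt_of_le_of_lt (Finset.sum_le_sum fun j _ => ?_) ht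
    refine (le_abs_self _).trans ?_
    rw [abs_mul]
    gcongr
    exact hR' _ (subset_convexHull ℝ _ ⟨k, rfl⟩) j
  obtain ⟨hs, heq⟩ := moment_series_of_bound hR' (le_max_right _ _) ht
  exact ⟨hs, by rw [heq, T.setIntegral_eq_ratGF hx],
    by rw [← T.setIntegral_eq_ratGF hx, T'.setIntegral_eq_ratGF hx]⟩
end

section
/- Let P = conv{x_1,…,x_m} ⊂ ℝ^d be a full-dimensional compact convex polytope and let Σ and Σ' be two triangulations of P using only the vertices x_1,…,x_m. Then the two polynomials ∑_{σ∈Σ} V_d(σ) ∏_{k∉σ} ℒ_k(t) and ∑_{σ∈Σ'} V_d(σ) ∏_{k∉σ} ℒ_k(t) are equal as polynomials in t = (t_1,…,t_d), where for each σ the product runs over the indices k ∈ {1,…,m} with x_k not a vertex of σ. In particular the adjoint polynomial Ad_P is independent of the triangulation used to define it. -/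
open MeasureTheory Finset

/-- The affine-linear polynomial `ℒ_k(t) = 1 − x_{k,1}t_1 − ⋯ − x_{k,d}t_d`,
as a polynomial in `t_1,…,t_d`. -/
noncomputable def Lpoly (d m : ℕ) (x : Fin m → (Fin d → ℝ)) (k : Fin m) :
    MvPolynomial (Fin d) ℝ :=
  1 - ∑ j, MvPolynomial.C (x k j) * MvPolynomial.X j

/-- The adjoint numerator `∑_{σ∈Σ} V_d(σ) ∏_{k∉σ} ℒ_k(t)` attached to a triangulation. -/
noncomputable def adjNum (d m : ℕ) (x : Fin m → (Fin d → ℝ)) (T : Triangulation d m x) :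
    MvPolynomial (Fin d) ℝ :=
  ∑ σ ∈ T.simplices,
    MvPolynomial.C ((volume (convexHull ℝ (x '' ↑σ))).toReal) * ∏ k ∈ σᶜ, Lpoly d m x k

/-- The open cone over `{1} × A`: pairs `(s, y)` with `s > 0` and `y ∈ s • A`. -/
def coneOver {d : ℕ} (A : Set (Fin d → ℝ)) : Set (ℝ × (Fin d → ℝ)) :=
  {p | 0 < p.1 ∧ p.1⁻¹ • p.2 ∈ A}

/-- The integral of `exp (-(s - ⟨y, t⟩))` over the cone over `A`. -/
noncomputable def coneLaplace {d : ℕ} (t : Fin d → ℝ) (A : Set (Fin d → ℝ)) : ENNReal :=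
  ∫⁻ p in coneOver A, ENNReal.ofReal (Real.exp (-(p.1 - ∑ j, p.2 j * t j)))

/-- The constant `∫₀^∞ s ^ d * exp (-s) ds`. -/
noncomputable def gammaConst (d : ℕ) : ENNReal :=
  ∫⁻ s in Set.Ioi (0 : ℝ), ENNReal.ofReal (Real.exp (-s) * s ^ d)

theorem gammaConst_ne_zero (d : ℕ) : gammaConst d ≠ 0 := by
  have hm : Measurable fun s : ℝ => ENNReal.ofReal (Real.exp (-s) * s ^ d) := by fun_prop
  rw [gammaConst, ← pos_iff_ne_zero, setLIntegral_pos_iff hm]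
  have hsub : Set.Ioi (0 : ℝ) ⊆
      (Function.support fun s : ℝ => ENNReal.ofReal (Real.exp (-s) * s ^ d)) ∩ Set.Ioi 0 := by
    intro s (hs : 0 < s)
    refine ⟨?_, hs⟩
    rw [Function.mem_support]
    exact (ENNReal.ofReal_pos.2 (by positivity)).ne'
  exact lt_of_lt_of_le (by simp) (measure_mono hsub)

theorem gammaConst_ne_top (d : ℕ) : gammaConst d ≠ ⊤ := by
  have h := Real.GammaIntegral_convergent (s := (d : ℝ) + 1) (by positivity)
  have h' : IntegrableOn (fun s : ℝ => Real.exp (-s) * s ^ d) (Set.Ioi 0) := by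
    simpa using h
  exact h'.lintegral_lt_top.ne

theorem measurableSet_coneOver {d : ℕ} {A : Set (Fin d → ℝ)} (hA : MeasurableSet A) :
    MeasurableSet (coneOver A) := by
  have h1 : Measurable fun p : ℝ × (Fin d → ℝ) => p.1⁻¹ • p.2 := by fun_prop
  exact (measurableSet_lt measurable_const measurable_fst).inter (h1 hA)

theorem coneLaplace_zero {d : ℕ} {A : Set (Fin d → ℝ)} (hA : MeasurableSet A) :
    coneLaplace 0 A = gammaConst d * volume A := by
  have hC := measurableSet_coneOver hA
  have hf : Measurable fun p : ℝ × (Fin d → ℝ) => ENNReal.ofReal (Real.exp (-p.1)) := by fun_prop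
  simp only [coneLaplace, Pi.zero_apply, mul_zero, sum_const_zero, sub_zero]
  rw [← lintegral_indicator hC, Measure.volume_eq_prod,
    lintegral_prod _ (hf.indicator hC).aemeasurable, gammaConst,
    ← lintegral_mul_const _ (by fun_prop), ← lintegral_indicator measurableSet_Ioi]
  refine lintegral_congr fun s => ?_
  by_cases hs : 0 < s
  · rw [Set.indicator_of_mem (show s ∈ Set.Ioi (0 : ℝ) from hs)]
    have hsA : MeasurableSet ((s⁻¹ • ·) ⁻¹' A : Set (Fin d → ℝ)) :=
      (measurable_const_smul s⁻¹) hA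
    have : ∀ y, (coneOver A).indicator
        (fun p : ℝ × (Fin d → ℝ) => ENNReal.ofReal (Real.exp (-p.1))) (s, y) =
        ((s⁻¹ • ·) ⁻¹' A : Set (Fin d → ℝ)).indicator
          (fun _ => ENNReal.ofReal (Real.exp (-s))) y := by
      intro y
      by_cases hy : s⁻¹ • y ∈ A <;> simp [Set.indicator, coneOver, hs, hy]
    simp_rw [this]
    rw [lintegral_indicator hsA, setLIntegral_const,
      Measure.addHaar_preimage_smul _ (inv_ne_zero hs.ne'), ← mul_assoc,
      ENNReal.ofReal_mul (Real.exp_pos _).le]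
    simp [abs_of_pos hs]
  · rw [Set.indicator_of_notMem (show s ∉ Set.Ioi (0 : ℝ) from hs)]
    simp [Set.indicator, coneOver, hs]

theorem volume_coneOver_eq_zero {d : ℕ} {A : Set (Fin d → ℝ)} (hA : MeasurableSet A)
    (h0 : volume A = 0) : volume (coneOver A) = 0 := by
  have h := coneLaplace_zero hA
  rw [h0, mul_zero, coneLaplace, setLIntegral_eq_zero_iff (measurableSet_coneOver hA)
    (by fun_prop)] at h
  rw [measure_eq_zero_iff_ae_notMem]
  filter_upwards [h] with p hp hpA
  exact (ENNReal.ofReal_pos.2 (Real.exp_pos _)).ne' (hp hpA)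

theorem lintegral_exp_orthant {ι : Type*} [Fintype ι] (a : ι → ℝ) (ha : ∀ i, 0 < a i) :
    ∫⁻ u in Set.univ.pi fun _ : ι => Set.Ioi (0 : ℝ), ENNReal.ofReal (Real.exp (-∑ i, a i * u i))
      = ENNReal.ofReal (∏ i, (a i)⁻¹) := by
  have h1 : ∀ i, IntegrableOn (fun v : ℝ => Real.exp (-a i * v)) (Set.Ioi 0) := fun i =>
    integrableOn_exp_mul_Ioi (neg_lt_zero.2 (ha i)) 0
  have hint := Integrable.fintype_prod (μ := fun _ : ι => volume.restrict (Set.Ioi (0 : ℝ)))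
    (f := fun i (v : ℝ) => Real.exp (-a i * v)) h1
  have hexp : ∀ u : ι → ℝ, Real.exp (-∑ i, a i * u i) = ∏ i, Real.exp (-a i * u i) := by
    intro u
    rw [← Real.exp_sum]
    simp [← sum_neg_distrib]
  rw [volume_pi, Measure.restrict_pi_pi]
  simp_rw [hexp]
  rw [← ofReal_integral_eq_lintegral_ofReal hint
    (Filter.Eventually.of_forall fun u => prod_nonneg fun i _ => (Real.exp_pos _).le),
    integral_fintype_prod_eq_prod (𝕜 := ℝ) (fun i (v : ℝ) => Real.exp (-a i * v))]
  congr 1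
  refine prod_congr rfl fun i _ => ?_
  rw [integral_exp_mul_Ioi (neg_lt_zero.2 (ha i))]
  simp

theorem convexHull_range_eq_image_stdSimplex {ι E : Type*} [Fintype ι] [AddCommGroup E]
    [Module ℝ E] (p : ι → E) :
    convexHull ℝ (Set.range p) = Fintype.linearCombination ℝ p '' stdSimplex ℝ ι := by
  classical
  rw [← convexHull_rangle_single_eq_stdSimplex, LinearMap.image_convexHull, ← Set.range_comp]
  congr 2
  ext i
  simp [Fintype.linearCombination_apply_single]

/-- Sends the standard basis to the lifted points `(1, p i)`. -/
noncomputable def liftMap {ι : Type*} [Fintype ι] {d : ℕ} (p : ι → Fin d → ℝ) :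
    (ι → ℝ) →ₗ[ℝ] ℝ × (Fin d → ℝ) :=
  Fintype.linearCombination ℝ fun i => ((1 : ℝ), p i)

theorem liftMap_apply {ι : Type*} [Fintype ι] {d : ℕ} (p : ι → Fin d → ℝ) (u : ι → ℝ) :
    liftMap p u = (∑ i, u i, ∑ i, u i • p i) := by
  ext <;> simp [liftMap, Fintype.linearCombination_apply, Prod.fst_sum, Prod.snd_sum]

theorem liftMap_injective {ι : Type*} [Fintype ι] {d : ℕ} {p : ι → Fin d → ℝ}
    (hp : AffineIndependent ℝ p) : Function.Injective (liftMap p) := by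
  rw [← LinearMap.ker_eq_bot, LinearMap.ker_eq_bot']
  intro u hu
  rw [liftMap_apply, Prod.mk_eq_zero] at hu
  ext i
  exact hp.eq_zero_of_sum_eq_zero hu.1 hu.2 i (mem_univ i)

theorem preimage_coneOver_ae_eq {ι : Type*} [Fintype ι] [Nonempty ι] {d : ℕ} {p : ι → Fin d → ℝ}
    (hp : AffineIndependent ℝ p) :
    liftMap p ⁻¹' coneOver (convexHull ℝ (Set.range p)) =ᵐ[volume]
      Set.univ.pi fun _ : ι => Set.Ioi (0 : ℝ) := by
  have hae : (Set.univ.pi fun _ : ι => Set.Ioi (0 : ℝ)) =ᵐ[volume] Set.Ici (0 : ι → ℝ) :=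
    Measure.univ_pi_Ioi_ae_eq_Ici
  have hsub : (Set.univ.pi fun _ : ι => Set.Ioi (0 : ℝ)) ⊆
      liftMap p ⁻¹' coneOver (convexHull ℝ (Set.range p)) := by
    intro u hu
    have hu' : ∀ i, 0 < u i := fun i => hu i (Set.mem_univ i)
    have hs : 0 < ∑ i, u i := sum_pos (fun i _ => hu' i) univ_nonempty
    rw [Set.mem_preimage, liftMap_apply, convexHull_range_eq_image_stdSimplex]
    refine ⟨hs, (∑ i, u i)⁻¹ • u, ⟨fun i => ?_, ?_⟩, ?_⟩
    · have := hu' i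
      simp only [Pi.smul_apply, smul_eq_mul]
      positivity
    · simp only [Pi.smul_apply, smul_eq_mul, ← mul_sum]
      exact inv_mul_cancel₀ hs.ne'
    · rw [map_smul, Fintype.linearCombination_apply]
  have hsup : liftMap p ⁻¹' coneOver (convexHull ℝ (Set.range p)) ⊆ Set.Ici 0 := by
    intro u hu
    rw [Set.mem_preimage, liftMap_apply, convexHull_range_eq_image_stdSimplex] at hu
    obtain ⟨hs, w, ⟨hw0, hw1⟩, hw⟩ := hu
    simp only at hs hw
    have huw : u = (∑ i, u i) • w := by
      apply liftMap_injective hp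
      rw [map_smul, liftMap_apply, liftMap_apply, hw1, ← Fintype.linearCombination_apply ℝ p w, hw]
      simp [smul_smul, hs.ne']
    rw [Set.mem_Ici, huw]
    exact smul_nonneg hs.le hw0
  refine Filter.EventuallyLE.antisymm ?_ hsub.eventuallyLE
  exact hsup.eventuallyLE.trans hae.symm.le

theorem exists_coneLaplace_simplex {ι : Type*} [Fintype ι] {d : ℕ} {p : ι → Fin d → ℝ}
    (hp : AffineIndependent ℝ p) (hcard : Fintype.card ι = d + 1) :
    ∃ c : ENNReal, ∀ t : Fin d → ℝ, (∀ i, 0 < 1 - ∑ j, p i j * t j) →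
      coneLaplace t (convexHull ℝ (Set.range p)) =
        c * ENNReal.ofReal (∏ i, (1 - ∑ j, p i j * t j)⁻¹) := by
  have hne : Nonempty ι := Fintype.card_pos_iff.1 (by omega)
  have hrank : Module.finrank ℝ (ι → ℝ) = Module.finrank ℝ (ℝ × (Fin d → ℝ)) := by
    simp [hcard, add_comm]
  let L : (ι → ℝ) ≃L[ℝ] ℝ × (Fin d → ℝ) :=
    (LinearMap.linearEquivOfInjective (liftMap p) (liftMap_injective hp)
      hrank).toContinuousLinearEquiv
  have hL : ∀ u, L u = liftMap p u := fun u => rfl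
  let ν : Measure (ℝ × (Fin d → ℝ)) := Measure.map L volume
  have hν : ν.IsAddHaarMeasure := L.isAddHaarMeasure_map volume
  have hvol : (volume : Measure (ℝ × (Fin d → ℝ))).IsAddHaarMeasure := by
    rw [Measure.volume_eq_prod]
    infer_instance
  obtain ⟨c, heq⟩ : ∃ c : NNReal, (volume : Measure (ℝ × (Fin d → ℝ))) = c • ν :=
    ⟨_, Measure.isAddLeftInvariant_eq_smul volume ν⟩
  refine ⟨c, fun t ht => ?_⟩
  have hmeas : MeasurableSet (convexHull ℝ (Set.range p)) :=
    ((Set.finite_range p).isCompact_convexHull ℝ).measurableSet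
  rw [coneLaplace, heq, Measure.restrict_smul, lintegral_smul_measure, ENNReal.smul_def,
    smul_eq_mul]
  congr 1
  rw [setLIntegral_map (measurableSet_coneOver hmeas) (by fun_prop) L.continuous.measurable,
    ← lintegral_exp_orthant _ ht]
  have hset : L ⁻¹' coneOver (convexHull ℝ (Set.range p)) =ᵐ[volume]
      Set.univ.pi fun _ : ι => Set.Ioi (0 : ℝ) := preimage_coneOver_ae_eq hp
  rw [setLIntegral_congr hset]
  refine lintegral_congr fun u => ?_
  rw [hL, liftMap_apply]
  congr 3
  simp only [Finset.sum_apply, Pi.smul_apply, smul_eq_mul, sub_mul, one_mul, sum_sub_distrib, sum_mul]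
  rw [sum_comm]
  congr 1
  exact sum_congr rfl fun i _ => sum_congr rfl fun j _ => by ring

theorem coneLaplace_simplex {ι : Type*} [Fintype ι] {d : ℕ} {p : ι → Fin d → ℝ}
    (hp : AffineIndependent ℝ p) (hcard : Fintype.card ι = d + 1) (t : Fin d → ℝ)
    (ht : ∀ i, 0 < 1 - ∑ j, p i j * t j) :
    coneLaplace t (convexHull ℝ (Set.range p)) =
      gammaConst d * volume (convexHull ℝ (Set.range p)) *
        ENNReal.ofReal (∏ i, (1 - ∑ j, p i j * t j)⁻¹) := by
  obtain ⟨c, hc⟩ := exists_coneLaplace_simplex hp hcard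
  have hmeas : MeasurableSet (convexHull ℝ (Set.range p)) :=
    ((Set.finite_range p).isCompact_convexHull ℝ).measurableSet
  have h0 := hc 0 (by simp)
  rw [coneLaplace_zero hmeas] at h0
  rw [hc t ht, h0]
  simp

theorem coneLaplace_biUnion {κ : Type*} {d : ℕ} (t : Fin d → ℝ) (S : Finset κ)
    (A : κ → Set (Fin d → ℝ)) (hconv : ∀ i ∈ S, Convex ℝ (A i)) (hcomp : ∀ i ∈ S, IsCompact (A i))
    (hdisj : ∀ i ∈ S, ∀ j ∈ S, i ≠ j → interior (A i) ∩ interior (A j) = ∅) :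
    coneLaplace t (⋃ i ∈ S, A i) = ∑ i ∈ S, coneLaplace t (A i) := by
  have hU : coneOver (⋃ i ∈ S, A i) = ⋃ i ∈ S, coneOver (A i) := by
    ext p
    simp [coneOver]
  rw [coneLaplace, hU, lintegral_biUnion_finset₀]
  · rfl
  · intro i hi j hj hij
    have hcap : coneOver (A i) ∩ coneOver (A j) = coneOver (A i ∩ A j) := by
      ext p
      simp only [coneOver, Set.mem_inter_iff, Set.mem_ofPred_eq]
      tauto
    change volume (coneOver (A i) ∩ coneOver (A j)) = 0
    rw [hcap]
    refine volume_coneOver_eq_zero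
      ((hcomp i hi).measurableSet.inter (hcomp j hj).measurableSet) ?_
    refine measure_mono_null (t := frontier (A i) ∪ frontier (A j)) ?_
      (measure_union_null ((hconv i hi).addHaar_frontier _) ((hconv j hj).addHaar_frontier _))
    rintro y ⟨hyi, hyj⟩
    by_contra hy
    rw [Set.mem_union, not_or] at hy
    have hi' : y ∈ interior (A i) := by
      by_contra h
      exact hy.1 ⟨subset_closure hyi, h⟩
    have hj' : y ∈ interior (A j) := by
      by_contra h
      exact hy.2 ⟨subset_closure hyj, h⟩
    exact (hdisj i hi j hj hij).subset ⟨hi', hj'⟩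
  · exact fun i hi => (measurableSet_coneOver (hcomp i hi).measurableSet).nullMeasurableSet

theorem eval_Lpoly (d m : ℕ) (x : Fin m → (Fin d → ℝ)) (k : Fin m) (t : Fin d → ℝ) :
    MvPolynomial.eval t (Lpoly d m x k) = 1 - ∑ j, x k j * t j := by
  simp [Lpoly]

theorem gammaConst_mul_eval_adjNum (d m : ℕ) (x : Fin m → (Fin d → ℝ)) (T : Triangulation d m x)
    (t : Fin d → ℝ) (ht : ∀ k, 0 < 1 - ∑ j, x k j * t j) :
    (gammaConst d).toReal * MvPolynomial.eval t (adjNum d m x T) =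
      (∏ k, (1 - ∑ j, x k j * t j)) *
        (coneLaplace t (convexHull ℝ (Set.range x))).toReal := by
  have hcompact : ∀ σ : Finset (Fin m), IsCompact (convexHull ℝ (x '' ↑σ)) := fun σ =>
    (σ.finite_toSet.image x).isCompact_convexHull ℝ
  have hsimp : ∀ σ ∈ T.simplices, coneLaplace t (convexHull ℝ (x '' ↑σ)) =
      gammaConst d * volume (convexHull ℝ (x '' ↑σ)) *
        ENNReal.ofReal (∏ k ∈ σ, (1 - ∑ j, x k j * t j)⁻¹) := by
    intro σ hσ
    have h := coneLaplace_simplex (T.indep σ hσ) (by simpa using T.card_eq σ hσ) t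
      fun i => ht i.1
    rw [prod_coe_sort σ fun k => (1 - ∑ j, x k j * t j)⁻¹] at h
    rwa [Set.image_eq_range]
  rw [← T.covers, coneLaplace_biUnion t T.simplices _ (fun σ _ => convex_convexHull ℝ _)
    (fun σ _ => hcompact σ) T.disj, sum_congr rfl hsimp, ENNReal.toReal_sum, adjNum, map_sum,
    mul_sum, mul_sum]
  · refine sum_congr rfl fun σ _ => ?_
    rw [ENNReal.toReal_mul, ENNReal.toReal_mul, ENNReal.toReal_ofReal
      (prod_nonneg fun k _ => (inv_pos.2 (ht k)).le), map_mul, MvPolynomial.eval_C, map_prod,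
      ← prod_mul_prod_compl σ fun k => 1 - ∑ j, x k j * t j, prod_inv_distrib]
    simp_rw [eval_Lpoly]
    have : ∏ k ∈ σ, (1 - ∑ j, x k j * t j) ≠ 0 := prod_ne_zero_iff.2 fun k _ => (ht k).ne'
    field_simp
  · exact fun σ _ => ENNReal.mul_ne_top
      (ENNReal.mul_ne_top (gammaConst_ne_top d) (hcompact σ).measure_lt_top.ne) ENNReal.ofReal_ne_top

theorem MvPolynomial.eq_of_eventually_eval_eq {ι : Type*} [Fintype ι] {p q : MvPolynomial ι ℝ}
    (h : ∀ᶠ t in nhds (0 : ι → ℝ), MvPolynomial.eval t p = MvPolynomial.eval t q) : p = q := by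
  obtain ⟨ε, hε, hball⟩ := Metric.eventually_nhds_iff_ball.1 h
  refine MvPolynomial.funext_set (fun _ => Metric.ball (0 : ℝ) ε) (fun _ => ?_) fun t ht => ?_
  · rw [Real.ball_eq_Ioo]
    exact Set.Ioo_infinite (by linarith)
  · refine hball t ?_
    rw [ball_pi _ hε]
    exact ht

/-- For a full-dimensional compact convex polytope
`P = conv{x_1,…,x_m} ⊆ ℝ^d` and any two triangulations `Σ, Σ'` of `P` using only
vertices of `P`, the polynomials `∑_{σ∈Σ} V_d(σ) ∏_{k∉σ} ℒ_k(t)` and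
`∑_{σ∈Σ'} V_d(σ) ∏_{k∉σ} ℒ_k(t)` coincide; in particular the adjoint polynomial
`Ad_P` does not depend on the triangulation used to define it. -/
theorem stmt_2 (d m : ℕ) (x : Fin m → (Fin d → ℝ))
    (hfull : (interior (convexHull ℝ (Set.range x))).Nonempty)
    (T T' : Triangulation d m x) :
    adjNum d m x T = adjNum d m x T' := by
  have hev : ∀ k, ∀ᶠ t : Fin d → ℝ in nhds 0, 0 < 1 - ∑ j, x k j * t j := by
    intro k
    have hc : Continuous fun t : Fin d → ℝ => 1 - ∑ j, x k j * t j := by fun_prop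
    exact hc.continuousAt.eventually (lt_mem_nhds (by simp))
  refine MvPolynomial.eq_of_eventually_eval_eq ?_
  filter_upwards [Filter.eventually_all.2 hev] with t ht
  have hK : (gammaConst d).toReal ≠ 0 :=
    ENNReal.toReal_ne_zero.2 ⟨gammaConst_ne_zero d, gammaConst_ne_top d⟩
  exact mul_left_cancel₀ hK ((gammaConst_mul_eval_adjNum d m x T t ht).trans
    (gammaConst_mul_eval_adjNum d m x T' t ht).symm)
end
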